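/- Let q be real with 0 < |q| < 1. The linear map Δ_β defined on finitely supported vectors of ℓ²(ℕ×ℕ×ℤ) by: for t ≥ 1, Δ_β e(r,s,t) = −q^{s+t} g(s+1) [g(r+1)/(g(r+s+t+1)g(r+s+t+2)) − 1] e(r+1,s+1,t−1) + q^s g(s+t) [g(r+t)/(g(r+s+t)g(r+s+t+1)) − 1] e(r,s,t−1); and for t ≤ 0, Δ_β e(r,s,t) = q^s g(s+|t|+1) [g(r+|t|+1)/(g(r+s+|t|+1)g(r+s+|t|+2)) − 1] e(r,s,t−1) − q^{s+|t|} g(s) [g(r)/(g(r+s+|t|)g(r+s+|t|+1)) − 1] e(r−1,s−1,t−1), where in the t ≤ 0 case the second summand is omitted when r = 0 or s = 0 and vectors e with a negative index are 0, extends to a compact operator on ℓ²(ℕ×ℕ×ℤ). Equivalently, U λ_q(β_q) U* − (I⊗π_q(β_q)) − D_β is compact, where D_β e(r,s,t) = −q^{s+t} g(s+1) e(r+1,s+1,t−1) + q^s (g(s+t)−1) e(r,s,t−1) for t ≥ 1, and D_β e(r,s,t) = q^s (g(s+|t|+1)−1) e(r,s,t−1) − q^{s+|t|} g(s) e(r−1,s−1,t−1)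 for t ≤ 0. -/

import Mathlib

noncomputable section

/-- The lattice Γ = {(n,i,j) : 2n ∈ ℕ, i,j ∈ {−n,…,n}}, in the integer coordinates
(m,a,b) = (2n, n+i, n+j): Γ = {(m,a,b) ∈ ℕ³ : a ≤ m ∧ b ≤ m}. -/
abbrev GammaIdx : Type := {x : ℕ × ℕ × ℕ // x.2.1 ≤ x.1 ∧ x.2.2 ≤ x.1}

/-- ℓ²(Γ) -/
abbrev l2G : Type := lp (fun _ : GammaIdx => ℂ) 2

/-- ℓ²(ℕ×ℕ×ℤ) -/
abbrev l2Z3 : Type := lp (fun _ : ℕ × ℕ × ℤ => ℂ) 2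

/-- The canonical orthonormal basis vector e^n_{i,j} of ℓ²(Γ), in coordinates
(m,a,b) = (2n, n+i, n+j); by convention it is 0 when (m,a,b) ∉ Γ. -/
def eG (m a b : ℕ) : l2G :=
  if h : a ≤ m ∧ b ≤ m then lp.single 2 (⟨(m, a, b), h⟩ : GammaIdx) 1 else 0

/-- The canonical orthonormal basis vector e(r,s,t) of ℓ²(ℕ×ℕ×ℤ); by convention
it is 0 when r < 0 or s < 0. -/
def eZ (r s t : ℤ) : l2Z3 :=
  if 0 ≤ r ∧ 0 ≤ s then lp.single 2 (r.toNat, s.toNat, t) 1 else 0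

/-- The canonical orthonormal basis vector e(r,s,t) of ℓ²(ℕ×ℕ×ℤ). -/
def e3 (r s : ℕ) (t : ℤ) : l2Z3 := lp.single 2 (r, s, t) 1

/-- g(k) = (1 − q^{2k})^{1/2}  (so g(0) = 0). -/
def gq (q : ℝ) (k : ℕ) : ℝ := Real.sqrt (1 - q ^ (2 * k))

/-- The defining property of the unitary U : ℓ²(Γ) → ℓ²(ℕ×ℕ×ℤ):
U e^n_{i,j} = (−1)^{max(i,j)−j} e(n−max(i,j), n+min(i,j), j−i), i.e.
U e(m,a,b) = (−1)^{max(a,b)−b} e(m−max(a,b), min(a,b), b−a). -/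
def IsU (U : l2G ≃ₗᵢ[ℂ] l2Z3) : Prop :=
  ∀ m a b : ℕ, a ≤ m → b ≤ m →
    U (eG m a b) = ((-1 : ℂ) ^ (max a b - b)) •
      eZ ((m : ℤ) - (max a b : ℤ)) (min a b) ((b : ℤ) - (a : ℤ))

/-- b₊(n,i,j) = −q^{n+j} g(n−j+1)g(n+i+1)/(g(2n+1)g(2n+2)), in coordinates
(m,a,b) = (2n, n+i, n+j): b₊ = −q^b g(m−b+1)g(a+1)/(g(m+1)g(m+2)). -/
def bP (q : ℝ) (m a b : ℕ) : ℝ :=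
  -(q ^ b * gq q (m - b + 1) * gq q (a + 1)) / (gq q (m + 1) * gq q (m + 2))

/-- b₋(n,i,j) = q^{n+i} g(n+j)g(n−i)/(g(2n)g(2n+1)), i.e.
b₋ = q^a g(b)g(m−a)/(g(m)g(m+1)) (for m ≥ 1). -/
def bM (q : ℝ) (m a b : ℕ) : ℝ :=
  q ^ a * gq q b * gq q (m - a) / (gq q m * gq q (m + 1))

/-- λ_q(β_q): in coordinates (m,a,b), e(m,a,b) ↦ b₊ e(m+1,a+1,b) + b₋ e(m−1,a,b−1),
the b₋ term being omitted when m = 0 (i.e. n = 0). -/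
def IsLambdaBeta (q : ℝ) (L : l2G →L[ℂ] l2G) : Prop :=
  ∀ m a b : ℕ, a ≤ m → b ≤ m →
    L (eG m a b) = ((bP q m a b : ℝ) : ℂ) • eG (m + 1) (a + 1) b +
      (if 1 ≤ m then ((bM q m a b : ℝ) : ℂ) • eG (m - 1) a (b - 1) else 0)

/-- For t ≥ 1: the coefficient −q^{s+t} g(s+1)[g(r+1)/(g(r+s+t+1)g(r+s+t+2)) − 1]. -/
def beta1 (q : ℝ) (r s : ℕ) (t : ℤ) : ℝ :=
  -q ^ (s + t.toNat) * gq q (s + 1) *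
    (gq q (r + 1) / (gq q (r + s + t.natAbs + 1) * gq q (r + s + t.natAbs + 2)) - 1)

/-- For t ≥ 1: the coefficient q^s g(s+t)[g(r+t)/(g(r+s+t)g(r+s+t+1)) − 1]. -/
def beta2 (q : ℝ) (r s : ℕ) (t : ℤ) : ℝ :=
  q ^ s * gq q (s + t.toNat) *
    (gq q (r + t.toNat) / (gq q (r + s + t.natAbs) * gq q (r + s + t.natAbs + 1)) - 1)

/-- For t ≤ 0: the coefficient q^s g(s+|t|+1)[g(r+|t|+1)/(g(r+s+|t|+1)g(r+s+|t|+2)) − 1]. -/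
def beta3 (q : ℝ) (r s : ℕ) (t : ℤ) : ℝ :=
  q ^ s * gq q (s + t.natAbs + 1) *
    (gq q (r + t.natAbs + 1) / (gq q (r + s + t.natAbs + 1) * gq q (r + s + t.natAbs + 2)) - 1)

/-- For t ≤ 0: the coefficient −q^{s+|t|} g(s)[g(r)/(g(r+s+|t|)g(r+s+|t|+1)) − 1]. -/
def beta4 (q : ℝ) (r s : ℕ) (t : ℤ) : ℝ :=
  -(q ^ (s + t.natAbs) * gq q s *
    (gq q r / (gq q (r + s + t.natAbs) * gq q (r + s + t.natAbs + 1)) - 1))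

open Filter Topology

section WeightedShifts

variable {ι : Type*}

/-- A bounded sequence acts on `ℓ²` by pointwise multiplication. -/
lemma exists_diagonal_operator (c : ι → ℂ) (C : ℝ) (hC : ∀ i, ‖c i‖ ≤ C) :
    ∃ M : lp (fun _ : ι => ℂ) 2 →L[ℂ] lp (fun _ : ι => ℂ) 2, ∀ x i, M x i = c i * x i := by
  have hle (x : lp (fun _ : ι => ℂ) 2) (i : ι) :
      ‖c i * x i‖ ≤ ‖((C : ℂ) • x : lp (fun _ : ι => ℂ) 2) i‖ := by
    rw [lp.coeFn_smul, Pi.smul_apply, norm_smul, norm_mul, Complex.norm_real]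
    gcongr
    exact (hC i).trans (le_abs_self C)
  let M : lp (fun _ : ι => ℂ) 2 →ₗ[ℂ] lp (fun _ : ι => ℂ) 2 :=
    { toFun := fun x => ⟨fun i => c i * x i, (lp.memℓp ((C : ℂ) • x)).mono' (hle x)⟩
      map_add' := fun x y => by
        ext i
        exact mul_add _ _ _
      map_smul' := fun a x => by
        ext i
        exact mul_left_comm _ _ _ }
  refine ⟨M.mkContinuous ‖(C : ℂ)‖ fun x => ?_, fun x i => rfl⟩
  rw [← norm_smul]
  exact lp.norm_mono two_ne_zero (hle x)

variable [DecidableEq ι]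

/-- Multiplication on `ℓ²` by a sequence tending to zero is a compact operator. -/
lemma exists_compact_diagonal_operator (c : ι → ℂ) (hc : Tendsto c cofinite (𝓝 0)) :
    ∃ M : lp (fun _ : ι => ℂ) 2 →L[ℂ] lp (fun _ : ι => ℂ) 2,
      (∀ i, M (lp.single 2 i 1) = c i • lp.single 2 i 1) ∧ IsCompactOperator M := by
  have hfin (ε : ℝ) (hε : 0 < ε) : {i | ε < ‖c i‖}.Finite := by
    have h := hc.norm.eventually_lt_const (by simpa using hε)
    refine (eventually_cofinite.1 h).subset fun i hi => ?_
    exact not_lt.2 (le_of_lt hi)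
  obtain ⟨C, hC⟩ : ∃ C, ∀ i, ‖c i‖ ≤ C := by
    refine ⟨1 + ∑ j ∈ (hfin 1 one_pos).toFinset, ‖c j‖, fun i => ?_⟩
    have hsum : 0 ≤ ∑ j ∈ (hfin 1 one_pos).toFinset, ‖c j‖ := by positivity
    by_cases hi : 1 < ‖c i‖
    · have := Finset.single_le_sum (f := fun j => ‖c j‖) (fun j _ => norm_nonneg _)
        ((hfin 1 one_pos).mem_toFinset.2 hi)
      linarith
    · linarith
  obtain ⟨M, hM⟩ := exists_diagonal_operator c C hC
  refine ⟨M, fun i => ?_, ?_⟩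
  · ext j
    rw [hM, lp.coeFn_smul, Pi.smul_apply, smul_eq_mul, lp.single_apply]
    obtain rfl | hij := eq_or_ne j i
    · rfl
    · simp [Pi.single_eq_of_ne hij]
  · refine isClosed_setOfPred_isCompactOperator.closure_subset
      (Metric.mem_closure_iff.2 fun ε hε => ?_)
    set F := (hfin (ε / 2) (half_pos hε)).toFinset with hF
    let T : lp (fun _ : ι => ℂ) 2 →L[ℂ] lp (fun _ : ι => ℂ) 2 :=
      ∑ i ∈ F, (lp.singleContinuousLinearMap ℂ (fun _ : ι => ℂ) 2 i).comp
        (c i • lp.evalCLM ℂ (fun _ : ι => ℂ) 2 i)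
    have hT (x : lp (fun _ : ι => ℂ) 2) (j : ι) : T x j = if j ∈ F then c j * x j else 0 := by
      simp only [T, FunLike.coe_sum, Finset.sum_apply, lp.coeFn_sum]
      refine Eq.trans (Finset.sum_congr rfl fun i _ => ?_)
        (Finset.sum_ite_eq F j fun i => c i * x i)
      obtain rfl | hij := eq_or_ne j i
      · simp [lp.evalCLM]
      · simp [hij, lp.evalCLM]
    have hTc : IsCompactOperator T := by
      have : T ∈ compactOperator (RingHom.id ℂ) (lp (fun _ : ι => ℂ) 2)
          (lp (fun _ : ι => ℂ) 2) :=
        Submodule.sum_mem _ fun i _ =>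
          (isCompactOperator_of_locallyCompactSpace_dom
            (c i • lp.evalCLM ℂ (fun _ : ι => ℂ) 2 i)).clm_comp
              (lp.singleContinuousLinearMap ℂ (fun _ : ι => ℂ) 2 i)
      exact this
    refine ⟨T, hTc, ?_⟩
    rw [dist_eq_norm]
    refine (ContinuousLinearMap.opNorm_le_bound _ (half_pos hε).le fun x => ?_).trans_lt
      (half_lt_self hε)
    have hnorm : ‖((ε / 2 : ℝ) : ℂ) • x‖ = ε / 2 * ‖x‖ := by
      rw [norm_smul, Complex.norm_real, Real.norm_of_nonneg (half_pos hε).le]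
    rw [← hnorm]
    refine lp.norm_mono two_ne_zero fun i => ?_
    rw [sub_apply, lp.coeFn_sub, Pi.sub_apply, hM, hT, lp.coeFn_smul, Pi.smul_apply, norm_smul,
      Complex.norm_real, Real.norm_of_nonneg (half_pos hε).le]
    split_ifs with hi
    · simp only [sub_self, norm_zero]
      positivity
    · rw [sub_zero, norm_mul]
      gcongr
      simpa [hF] using hi

/-- An injection of the index set induces an isometry permuting the canonical basis of `ℓ²`. -/
lemma exists_isometry_of_injective (σ : ι → ι) (hσ : Function.Injective σ) :
    ∃ S : lp (fun _ : ι => ℂ) 2 →ₗᵢ[ℂ] lp (fun _ : ι => ℂ) 2,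
      ∀ i, S (lp.single 2 i 1) = lp.single 2 (σ i) 1 := by
  have hv : Orthonormal ℂ fun i : ι => (lp.single 2 (σ i) 1 : lp (fun _ : ι => ℂ) 2) := by
    rw [orthonormal_iff_ite]
    intro i j
    rw [lp.inner_single_left, lp.single_apply, Pi.single_apply]
    simp [hσ.eq_iff]
  exact ⟨hv.orthogonalFamily.linearIsometry, fun i => by simp⟩

/-- A weighted shift along an injection, with weights tending to zero, is compact. -/
lemma exists_compact_weighted_shift (σ : ι → ι) (hσ : Function.Injective σ) (c : ι → ℂ)
    (hc : Tendsto c cofinite (𝓝 0)) :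
    ∃ D : lp (fun _ : ι => ℂ) 2 →L[ℂ] lp (fun _ : ι => ℂ) 2,
      (∀ i, D (lp.single 2 i 1) = c i • lp.single 2 (σ i) 1) ∧ IsCompactOperator D := by
  obtain ⟨M, hM, hMc⟩ := exists_compact_diagonal_operator c hc
  obtain ⟨S, hS⟩ := exists_isometry_of_injective σ hσ
  refine ⟨S.toContinuousLinearMap.comp M, fun i => ?_, hMc.clm_comp _⟩
  simp [hM, hS]

/-- A weighted backward shift along an injection, with weights tending to zero and supported on
the range of the injection, is compact. -/
lemma exists_compact_weighted_backward_shift (σ : ι → ι) (hσ : Function.Injective σ) (c : ι → ℂ)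
    (hc : Tendsto c cofinite (𝓝 0)) :
    ∃ D : lp (fun _ : ι => ℂ) 2 →L[ℂ] lp (fun _ : ι => ℂ) 2,
      (∀ i, D (lp.single 2 (σ i) 1) = c (σ i) • lp.single 2 i 1) ∧
      (∀ i, c i = 0 → D (lp.single 2 i 1) = 0) ∧ IsCompactOperator D := by
  obtain ⟨M, hM, hMc⟩ := exists_compact_diagonal_operator c hc
  obtain ⟨S, hS⟩ := exists_isometry_of_injective σ hσ
  refine ⟨(ContinuousLinearMap.adjoint S.toContinuousLinearMap).comp M, fun i => ?_, fun i hi => ?_,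
    hMc.clm_comp (ContinuousLinearMap.adjoint S.toContinuousLinearMap)⟩
  · have h := DFunLike.congr_fun S.adjoint_comp_self (lp.single 2 i 1)
    simp only [ContinuousLinearMap.comp_apply, LinearIsometry.coe_toContinuousLinearMap, hS] at h
    simp [hM, h]
  · simp [hM, hi]

end WeightedShifts

section Coefficients

variable {q : ℝ}

lemma gq_zero (q : ℝ) : gq q 0 = 0 := by simp [gq]

lemma gq_nonneg (q : ℝ) (k : ℕ) : 0 ≤ gq q k := Real.sqrt_nonneg _

lemma gq_le_one (q : ℝ) (k : ℕ) : gq q k ≤ 1 := by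
  refine Real.sqrt_le_one.2 ?_
  have : 0 ≤ q ^ (2 * k) := (even_two_mul k).pow_nonneg q
  linarith

lemma one_sub_gq_le (h1 : |q| < 1) (k : ℕ) : 1 - gq q k ≤ |q| ^ k := by
  have hu : q ^ (2 * k) ≤ |q| ^ k := by
    rw [← (even_two_mul k).pow_abs]
    exact pow_le_pow_of_le_one (abs_nonneg q) h1.le (by omega)
  have hu0 : 0 ≤ q ^ (2 * k) := (even_two_mul k).pow_nonneg q
  have hu1 : |q| ^ k ≤ 1 := pow_le_one₀ (abs_nonneg q) h1.le
  have : 1 - q ^ (2 * k) ≤ gq q k :=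
    Real.le_sqrt_of_sq_le (by nlinarith)
  linarith

lemma gq_one_le (h1 : |q| < 1) {n : ℕ} (hn : 1 ≤ n) : gq q 1 ≤ gq q n := by
  refine Real.sqrt_le_sqrt (sub_le_sub_left ?_ 1)
  rw [← (even_two_mul n).pow_abs, ← (even_two_mul 1).pow_abs]
  exact pow_le_pow_of_le_one (abs_nonneg q) h1.le (by omega)

lemma gq_one_pos (h1 : |q| < 1) : 0 < gq q 1 :=
  Real.sqrt_pos.2 (sub_pos.2 (by simpa using h1))

lemma abs_gq_ratio_sub_one_le (h1 : |q| < 1) {a n : ℕ} (hn : 1 ≤ n) (han : a ≤ n) :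
    |gq q a / (gq q n * gq q (n + 1)) - 1| ≤ 3 / gq q 1 ^ 2 * |q| ^ a := by
  have hpos := gq_one_pos h1
  have hn1 := gq_one_le h1 hn
  have hn2 : gq q 1 ≤ gq q (n + 1) := gq_one_le h1 (by omega)
  have hden : gq q 1 ^ 2 ≤ gq q n * gq q (n + 1) := by nlinarith
  have hden0 : 0 < gq q n * gq q (n + 1) := by nlinarith
  have ea := one_sub_gq_le h1 a
  have en := (one_sub_gq_le h1 n).trans (pow_le_pow_of_le_one (abs_nonneg q) h1.le han)
  have en' := (one_sub_gq_le h1 (n + 1)).trans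
    (pow_le_pow_of_le_one (abs_nonneg q) h1.le (by omega : a ≤ n + 1))
  have hnum : |gq q a - gq q n * gq q (n + 1)| ≤ 3 * |q| ^ a := by
    have ha := gq_le_one q a
    have hl := gq_le_one q n
    have hl' := gq_le_one q (n + 1)
    have ha0 := gq_nonneg q a
    rw [abs_le]
    constructor <;> nlinarith
  rw [div_sub_one hden0.ne', abs_div, abs_of_pos hden0, div_mul_eq_mul_div]
  gcongr

lemma abs_weight_le (h1 : |q| < 1) (j k : ℕ) {a n : ℕ} (hn : 1 ≤ n) (han : a ≤ n) :
    |q ^ j * gq q k * (gq q a / (gq q n * gq q (n + 1)) - 1)| ≤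
      3 / gq q 1 ^ 2 * |q| ^ (j + a) := by
  rw [abs_mul, abs_mul, abs_pow, abs_of_nonneg (gq_nonneg q k)]
  calc |q| ^ j * gq q k * |gq q a / (gq q n * gq q (n + 1)) - 1|
      ≤ |q| ^ j * 1 * (3 / gq q 1 ^ 2 * |q| ^ a) := by
        gcongr
        · exact gq_le_one q k
        · exact abs_gq_ratio_sub_one_le h1 hn han
    _ = 3 / gq q 1 ^ 2 * |q| ^ (j + a) := by ring

lemma const_mul_pow_le (h1 : |q| < 1) {j k : ℕ} (h : k ≤ j) :
    3 / gq q 1 ^ 2 * |q| ^ j ≤ 3 / gq q 1 ^ 2 * |q| ^ k :=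
  mul_le_mul_of_nonneg_left (pow_le_pow_of_le_one (abs_nonneg q) h1.le h) (by positivity)

lemma abs_beta1_le (h1 : |q| < 1) (r s : ℕ) {t : ℤ} (ht : 1 ≤ t) :
    |beta1 q r s t| ≤ 3 / gq q 1 ^ 2 * |q| ^ (r + s + t.natAbs) := by
  rw [beta1, neg_mul, neg_mul, abs_neg]
  exact (abs_weight_le h1 _ _ (by omega) (by omega)).trans (const_mul_pow_le h1 (by omega))

lemma abs_beta2_le (h1 : |q| < 1) (r s : ℕ) {t : ℤ} (ht : 1 ≤ t) :
    |beta2 q r s t| ≤ 3 / gq q 1 ^ 2 * |q| ^ (r + s + t.natAbs) :=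
  (abs_weight_le h1 _ _ (by omega) (by omega)).trans (const_mul_pow_le h1 (by omega))

lemma abs_beta3_le (h1 : |q| < 1) (r s : ℕ) (t : ℤ) :
    |beta3 q r s t| ≤ 3 / gq q 1 ^ 2 * |q| ^ (r + s + t.natAbs) :=
  (abs_weight_le h1 _ _ (by omega) (by omega)).trans (const_mul_pow_le h1 (by omega))

lemma abs_beta4_le (h1 : |q| < 1) (r : ℕ) {s : ℕ} (hs : s ≠ 0) (t : ℤ) :
    |beta4 q r s t| ≤ 3 / gq q 1 ^ 2 * |q| ^ (r + s + t.natAbs) := by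
  rw [beta4, abs_neg]
  exact (abs_weight_le h1 _ _ (by omega) (by omega)).trans (const_mul_pow_le h1 (by omega))

lemma tendsto_cofinite_zero_of_le_pow (h1 : |q| < 1) {C : ℝ} {f : ℕ × ℕ × ℤ → ℝ}
    (hf : ∀ r s t, |f (r, s, t)| ≤ C * |q| ^ (r + s + t.natAbs)) :
    Tendsto (fun i => (f i : ℂ)) cofinite (𝓝 0) := by
  have hN : Summable fun n : ℕ => |q| ^ n := summable_geometric_of_lt_one (abs_nonneg q) h1
  have hZ : Summable fun t : ℤ => |q| ^ t.natAbs :=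
    Summable.of_nat_of_neg (by simpa using hN) (by simpa using hN)
  have hsum := hN.mul_of_nonneg (hN.mul_of_nonneg hZ (fun _ => by positivity)
    (fun _ => by positivity)) (fun _ => by positivity) (fun _ => by positivity)
  refine squeeze_zero_norm (fun i => ?_) (by simpa using (hsum.mul_left C).tendsto_cofinite_zero)
  obtain ⟨r, s, t⟩ := i
  rw [Complex.norm_real, Real.norm_eq_abs]
  refine (hf r s t).trans_eq ?_
  ring

end Coefficients

section BasisVectors

lemma eZ_natCast (r s : ℕ) (t : ℤ) : eZ r s t = e3 r s t := by simp [eZ, e3]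

lemma eZ_natCast_sub_one {r s : ℕ} (h : r = 0 ∨ s = 0) (t : ℤ) :
    eZ ((r : ℤ) - 1) ((s : ℤ) - 1) t = 0 := by
  rw [eZ, if_neg]
  omega

lemma eZ_succ_sub_one (r s : ℕ) (t : ℤ) :
    eZ (((r + 1 : ℕ) : ℤ) - 1) (((s + 1 : ℕ) : ℤ) - 1) t = e3 r s t := by
  simp [eZ, e3]

lemma clm_ext_e3 {F : Type*} [NormedAddCommGroup F] [NormedSpace ℂ F] {S T : l2Z3 →L[ℂ] F}
    (h : ∀ r s t, S (e3 r s t) = T (e3 r s t)) : S = T := by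
  refine lp.ext_continuousLinearMap (by simp) fun i => ?_
  ext
  exact h i.1 i.2.1 i.2.2

end BasisVectors

/-- The map Δ_β extends to a compact operator. -/
lemma exists_compact_extension {q : ℝ} (h1 : |q| < 1) :
    ∃ D : l2Z3 →L[ℂ] l2Z3,
      (∀ (r s : ℕ) (t : ℤ),
        (1 ≤ t →
          D (e3 r s t) = ((beta1 q r s t : ℝ) : ℂ) • e3 (r + 1) (s + 1) (t - 1) +
            ((beta2 q r s t : ℝ) : ℂ) • e3 r s (t - 1)) ∧
        (t ≤ 0 →
          D (e3 r s t) = ((beta3 q r s t : ℝ) : ℂ) • e3 r s (t - 1) +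
            (if r = 0 ∨ s = 0 then 0 else
              ((beta4 q r s t : ℝ) : ℂ) • eZ ((r : ℤ) - 1) ((s : ℤ) - 1) (t - 1)))) ∧
      IsCompactOperator (⇑D) := by
  let up : ℕ × ℕ × ℤ → ℝ := fun i => if 1 ≤ i.2.2 then beta1 q i.1 i.2.1 i.2.2 else 0
  let mid : ℕ × ℕ × ℤ → ℝ := fun i =>
    if 1 ≤ i.2.2 then beta2 q i.1 i.2.1 i.2.2 else beta3 q i.1 i.2.1 i.2.2
  let down : ℕ × ℕ × ℤ → ℝ := fun i =>
    if 1 ≤ i.2.2 ∨ i.1 = 0 ∨ i.2.1 = 0 then 0 else beta4 q i.1 i.2.1 i.2.2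
  obtain ⟨D₁, hD₁, hc₁⟩ := exists_compact_weighted_shift
    (fun i : ℕ × ℕ × ℤ => (i.1 + 1, i.2.1 + 1, i.2.2 - 1))
    (fun ⟨_, _, _⟩ ⟨_, _, _⟩ h => by simpa using h) (fun i => (up i : ℂ))
    (tendsto_cofinite_zero_of_le_pow h1 (C := 3 / gq q 1 ^ 2) fun r s t => by
      dsimp only [up]
      split_ifs with ht
      · exact abs_beta1_le h1 r s ht
      · rw [abs_zero]
        positivity)
  obtain ⟨D₂, hD₂, hc₂⟩ := exists_compact_weighted_shift
    (fun i : ℕ × ℕ × ℤ => (i.1, i.2.1, i.2.2 - 1))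
    (fun ⟨_, _, _⟩ ⟨_, _, _⟩ h => by simpa using h) (fun i => (mid i : ℂ))
    (tendsto_cofinite_zero_of_le_pow h1 (C := 3 / gq q 1 ^ 2) fun r s t => by
      dsimp only [mid]
      split_ifs with ht
      · exact abs_beta2_le h1 r s ht
      · exact abs_beta3_le h1 r s t)
  obtain ⟨D₃, hD₃, hD₃', hc₃⟩ := exists_compact_weighted_backward_shift
    (fun i : ℕ × ℕ × ℤ => (i.1 + 1, i.2.1 + 1, i.2.2 + 1))
    (fun ⟨_, _, _⟩ ⟨_, _, _⟩ h => by simpa using h) (fun i => (down i : ℂ))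
    (tendsto_cofinite_zero_of_le_pow h1 (C := 3 / gq q 1 ^ 2) fun r s t => by
      dsimp only [down]
      split_ifs with ht
      · rw [abs_zero]
        positivity
      · exact abs_beta4_le h1 r (fun hs => ht (Or.inr (Or.inr hs))) t)
  refine ⟨D₁ + D₂ + D₃, fun r s t => ⟨fun ht => ?_, fun ht => ?_⟩, (hc₁.add hc₂).add hc₃⟩
  · have e₁ : D₁ (e3 r s t) = ((beta1 q r s t : ℝ) : ℂ) • e3 (r + 1) (s + 1) (t - 1) := by
      simpa [up, ht] using! hD₁ (r, s, t)
    have e₂ : D₂ (e3 r s t) = ((beta2 q r s t : ℝ) : ℂ) • e3 r s (t - 1) := by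
      simpa [mid, ht] using! hD₂ (r, s, t)
    have e₃ : D₃ (e3 r s t) = 0 := hD₃' (r, s, t) (by simp [down, ht])
    rw [add_apply, add_apply, e₁, e₂, e₃, add_zero]
  · have ht' : ¬ 1 ≤ t := by omega
    have e₁ : D₁ (e3 r s t) = 0 := by
      refine (hD₁ (r, s, t)).trans ?_
      simp [up, ht']
    have e₂ : D₂ (e3 r s t) = ((beta3 q r s t : ℝ) : ℂ) • e3 r s (t - 1) := by
      refine (hD₂ (r, s, t)).trans ?_
      simp [mid, ht', e3]
    rw [add_apply, add_apply, e₁, e₂, zero_add]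
    congr 1
    split_ifs with hrs
    · exact hD₃' (r, s, t) (by simp [down, hrs])
    · obtain ⟨r, rfl⟩ := Nat.exists_eq_succ_of_ne_zero fun h => hrs (Or.inl h)
      obtain ⟨s, rfl⟩ := Nat.exists_eq_succ_of_ne_zero fun h => hrs (Or.inr h)
      have h := hD₃ (r, s, t - 1)
      simp only [sub_add_cancel] at h
      rw [Nat.succ_eq_add_one, Nat.succ_eq_add_one, eZ_succ_sub_one]
      refine h.trans ?_
      simp [down, ht', e3]

section Conjugation

variable {q : ℝ} {U : l2G ≃ₗᵢ[ℂ] l2Z3} {L : l2G →L[ℂ] l2G}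

lemma IsU.apply_eG (hU : IsU U) {m a b r s : ℕ} (hr : m = r + max a b) (hs : s = min a b) :
    U (eG m a b) = ((-1 : ℂ) ^ (max a b - b)) • e3 r s ((b : ℤ) - a) := by
  rw [hU m a b (by omega) (by omega), ← eZ_natCast]
  congr 2 <;> omega

lemma IsU.conj_apply_of_one_le (hU : IsU U) (hL : IsLambdaBeta q L) (r s : ℕ) {t : ℤ}
    (ht : 1 ≤ t) :
    U (L (U.symm (e3 r s t))) =
      ((bP q (r + s + t.natAbs) s (s + t.natAbs) : ℝ) : ℂ) • e3 (r + 1) (s + 1) (t - 1) +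
        ((bM q (r + s + t.natAbs) s (s + t.natAbs) : ℝ) : ℂ) • e3 r s (t - 1) := by
  have h : e3 r s t = U (eG (r + s + t.natAbs) s (s + t.natAbs)) := by
    rw [hU.apply_eG (r := r) (s := s) (by omega) (by omega), max_eq_right (by omega),
      Nat.sub_self, pow_zero, one_smul]
    congr 1
    omega
  rw [h, U.symm_apply_apply, hL _ _ _ (by omega) (by omega), if_pos (by omega), map_add, map_smul,
    map_smul, hU.apply_eG (r := r + 1) (s := s + 1) (by omega) (by omega),
    hU.apply_eG (r := r) (s := s) (by omega) (by omega), max_eq_right (by omega),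
    max_eq_right (by omega), Nat.sub_self, Nat.sub_self, pow_zero, one_smul, one_smul]
  congr 3 <;> omega

lemma IsU.conj_apply_of_nonpos (hU : IsU U) (hL : IsLambdaBeta q L) (r s : ℕ) {t : ℤ}
    (ht : t ≤ 0) :
    U (L (U.symm (e3 r s t))) =
      ((-bP q (r + s + t.natAbs) (s + t.natAbs) s : ℝ) : ℂ) • e3 r s (t - 1) +
        ((-bM q (r + s + t.natAbs) (s + t.natAbs) s : ℝ) : ℂ) •
          eZ ((r : ℤ) - 1) ((s : ℤ) - 1) (t - 1) := by
  have h : e3 r s t = U ((-1 : ℂ) ^ t.natAbs • eG (r + s + t.natAbs) (s + t.natAbs) s) := by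
    rw [map_smul, hU.apply_eG (r := r) (s := s) (by omega) (by omega), max_eq_left (by omega),
      Nat.add_sub_cancel_left, smul_smul, ← mul_pow, neg_one_mul, neg_neg, one_pow, one_smul]
    congr 1
    omega
  have hsq : (-1 : ℂ) ^ t.natAbs * (-1) ^ t.natAbs = 1 := by
    rw [← mul_pow, neg_one_mul, neg_neg, one_pow]
  have hfst : U (eG (r + s + t.natAbs + 1) (s + t.natAbs + 1) s) =
      (-1 : ℂ) ^ (t.natAbs + 1) • e3 r s (t - 1) := by
    rw [hU.apply_eG (r := r) (s := s) (by omega) (by omega), max_eq_left (by omega)]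
    congr 2 <;> omega
  have hsnd : U (if 1 ≤ r + s + t.natAbs then
        ((bM q (r + s + t.natAbs) (s + t.natAbs) s : ℝ) : ℂ) •
          eG (r + s + t.natAbs - 1) (s + t.natAbs) (s - 1) else 0) =
      ((bM q (r + s + t.natAbs) (s + t.natAbs) s : ℝ) : ℂ) • (-1 : ℂ) ^ (t.natAbs + 1) •
        eZ ((r : ℤ) - 1) ((s : ℤ) - 1) (t - 1) := by
    by_cases hrs : r = 0 ∨ s = 0
    · have : bM q (r + s + t.natAbs) (s + t.natAbs) s = 0 := by
        obtain rfl | rfl := hrs <;> simp [bM, gq_zero]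
      simp [this, eZ_natCast_sub_one hrs]
    · obtain ⟨r, rfl⟩ := Nat.exists_eq_add_one_of_ne_zero fun h => hrs (Or.inl h)
      obtain ⟨s, rfl⟩ := Nat.exists_eq_add_one_of_ne_zero fun h => hrs (Or.inr h)
      rw [if_pos (by omega), map_smul, eZ_succ_sub_one, hU.apply_eG (r := r) (s := s) (by omega) (by omega),
        max_eq_left (by omega)]
      congr 3 <;> omega
  rw [h, U.symm_apply_apply, map_smul, hL _ _ _ (by omega) (by omega), map_smul, map_add, map_smul,
    hfst, hsnd, smul_add, smul_smul, smul_smul, smul_smul, smul_smul]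
  push_cast
  congr 2
  · linear_combination (-(bP q (r + s + t.natAbs) (s + t.natAbs) s : ℂ)) * hsq
  · linear_combination (-(bM q (r + s + t.natAbs) (s + t.natAbs) s : ℂ)) * hsq

end Conjugation

section CoefficientIdentities

variable (q : ℝ) (r s : ℕ) (t : ℤ)

lemma bP_eq_of_one_le (ht : 1 ≤ t) :
    bP q (r + s + t.natAbs) s (s + t.natAbs) =
      -q ^ (s + t.toNat) * gq q (s + 1) + beta1 q r s t := by
  have h₁ : r + s + t.natAbs - (s + t.natAbs) + 1 = r + 1 := by omega
  have h₂ : t.toNat = t.natAbs := by omega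
  rw [bP, beta1, h₁, h₂]
  ring

lemma bM_eq_of_one_le (ht : 1 ≤ t) :
    bM q (r + s + t.natAbs) s (s + t.natAbs) =
      q ^ s + q ^ s * (gq q (s + t.toNat) - 1) + beta2 q r s t := by
  have h₁ : r + s + t.natAbs - s = r + t.natAbs := by omega
  have h₂ : t.toNat = t.natAbs := by omega
  rw [bM, beta2, h₁, h₂]
  ring

lemma neg_bP_eq :
    -bP q (r + s + t.natAbs) (s + t.natAbs) s =
      q ^ s + q ^ s * (gq q (s + t.natAbs + 1) - 1) + beta3 q r s t := by
  have h₁ : r + s + t.natAbs - s + 1 = r + t.natAbs + 1 := by omega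
  rw [bP, beta3, h₁]
  ring

lemma neg_bM_eq :
    -bM q (r + s + t.natAbs) (s + t.natAbs) s =
      -(q ^ (s + t.natAbs) * gq q s) + beta4 q r s t := by
  have h₁ : r + s + t.natAbs - (s + t.natAbs) = r := by omega
  rw [bM, beta4, h₁]
  ring

end CoefficientIdentities

/-- the map Δ_β, given for t ≥ 1 by
e(r,s,t) ↦ β₁ e(r+1,s+1,t−1) + β₂ e(r,s,t−1) and for t ≤ 0 by
e(r,s,t) ↦ β₃ e(r,s,t−1) + β₄ e(r−1,s−1,t−1) (the β₄ summand omitted when r = 0 or s = 0),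
extends to a compact operator on ℓ²(ℕ×ℕ×ℤ); equivalently,
U λ_q(β_q) U* − (I⊗π_q(β_q)) − D_β is compact, where (I⊗π_q(β_q)) e(r,s,t) = q^s e(r,s,t−1)
and D_β e(r,s,t) = −q^{s+t} g(s+1) e(r+1,s+1,t−1) + q^s(g(s+t)−1) e(r,s,t−1) for t ≥ 1,
D_β e(r,s,t) = q^s(g(s+|t|+1)−1) e(r,s,t−1) − q^{s+|t|} g(s) e(r−1,s−1,t−1) for t ≤ 0. -/
theorem stmt18 (q : ℝ) (h0 : 0 < |q|) (h1 : |q| < 1) :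
    (∃ D : l2Z3 →L[ℂ] l2Z3,
      (∀ (r s : ℕ) (t : ℤ),
        (1 ≤ t →
          D (e3 r s t) = ((beta1 q r s t : ℝ) : ℂ) • e3 (r + 1) (s + 1) (t - 1) +
            ((beta2 q r s t : ℝ) : ℂ) • e3 r s (t - 1)) ∧
        (t ≤ 0 →
          D (e3 r s t) = ((beta3 q r s t : ℝ) : ℂ) • e3 r s (t - 1) +
            (if r = 0 ∨ s = 0 then 0 else
              ((beta4 q r s t : ℝ) : ℂ) • eZ ((r : ℤ) - 1) ((s : ℤ) - 1) (t - 1)))) ∧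
      IsCompactOperator (⇑D)) ∧
    (∀ (U : l2G ≃ₗᵢ[ℂ] l2Z3), IsU U →
      ∀ (Lβ : l2G →L[ℂ] l2G), IsLambdaBeta q Lβ →
      ∀ (Pβ : l2Z3 →L[ℂ] l2Z3),
        (∀ (r s : ℕ) (t : ℤ), Pβ (e3 r s t) = ((q ^ s : ℝ) : ℂ) • e3 r s (t - 1)) →
      ∀ (Dβ : l2Z3 →L[ℂ] l2Z3),
        (∀ (r s : ℕ) (t : ℤ),
          (1 ≤ t →
            Dβ (e3 r s t) = ((-q ^ (s + t.toNat) * gq q (s + 1) : ℝ) : ℂ) •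
                e3 (r + 1) (s + 1) (t - 1) +
              ((q ^ s * (gq q (s + t.toNat) - 1) : ℝ) : ℂ) • e3 r s (t - 1)) ∧
          (t ≤ 0 →
            Dβ (e3 r s t) = ((q ^ s * (gq q (s + t.natAbs + 1) - 1) : ℝ) : ℂ) •
                e3 r s (t - 1) +
              ((-(q ^ (s + t.natAbs) * gq q s) : ℝ) : ℂ) •
                eZ ((r : ℤ) - 1) ((s : ℤ) - 1) (t - 1))) →
      IsCompactOperator (fun ξ : l2Z3 => U (Lβ (U.symm ξ)) - Pβ ξ - Dβ ξ)) := by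
  obtain ⟨D, hD, hDc⟩ := exists_compact_extension h1
  refine ⟨⟨D, hD, hDc⟩, fun U hU Lβ hL Pβ hP Dβ hDβ => ?_⟩
  have key : (U.toContinuousLinearEquiv : l2G →L[ℂ] l2Z3).comp
      (Lβ.comp (U.symm.toContinuousLinearEquiv : l2Z3 →L[ℂ] l2G)) - Pβ - Dβ = D := by
    refine clm_ext_e3 fun r s t => ?_
    change U (Lβ (U.symm (e3 r s t))) - Pβ (e3 r s t) - Dβ (e3 r s t) = D (e3 r s t)
    rcases le_or_gt 1 t with ht | ht
    · rw [hU.conj_apply_of_one_le hL r s ht, hP, (hDβ r s t).1 ht, (hD r s t).1 ht,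
        bP_eq_of_one_le q r s t ht, bM_eq_of_one_le q r s t ht]
      simp only [Complex.ofReal_add, add_smul]
      abel
    · have ht : t ≤ 0 := by omega
      have hlast : (if r = 0 ∨ s = 0 then 0 else
            ((beta4 q r s t : ℝ) : ℂ) • eZ ((r : ℤ) - 1) ((s : ℤ) - 1) (t - 1)) =
          ((beta4 q r s t : ℝ) : ℂ) • eZ ((r : ℤ) - 1) ((s : ℤ) - 1) (t - 1) := by
        split_ifs with hrs
        · rw [eZ_natCast_sub_one hrs, smul_zero]
        · rfl
      rw [hU.conj_apply_of_nonpos hL r s ht, hP, (hDβ r s t).2 ht, (hD r s t).2 ht, hlast,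
        neg_bP_eq, neg_bM_eq]
      simp only [Complex.ofReal_add, add_smul]
      abel
  rw [← key] at hDc
  exact hDc
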